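/- Let M = (Q, W, R) be a hereditary abelian model structure on an abelian category A, and define ℓExtⁿ_M(A,B) := Hⁿ[Hom_A(W_A, B)] for an M-resolution W_A of A. If A is cofibrant (A ∈ Q) and B is trivially fibrant (B ∈ W ∩ R), or A is trivially cofibrant (A ∈ Q ∩ W) and B is fibrant (B ∈ R), then ℓExtⁿ_M(A,B) = 0 for all integers n. -/

import Mathlib

open CategoryTheory CategoryTheory.Limits

universe w v u

variable {C : Type u} [Category.{v} C] [Abelian C]

/-- A hereditary abelian model structure (Hovey triple) `(𝒬, 𝒲, ℛ)` on an abelian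
category: `𝒲` is thick, `(𝒬, 𝒲 ∩ ℛ)` and `(𝒬 ∩ 𝒲, ℛ)` are complete cotorsion pairs, and
both cotorsion pairs are hereditary (`Extⁱ` vanishes for all `i ≥ 1`). -/
structure HoveyTriple (C : Type u) [Category.{v} C] [Abelian C] [HasExt.{w} C] where
  Q : C → Prop
  W : C → Prop
  R : C → Prop
  /-- `𝒲` is closed under retracts. -/
  thick_retract : ∀ ⦃X Y : C⦄, (∃ (s : Y ⟶ X) (r : X ⟶ Y), s ≫ r = 𝟙 Y) → W X → W Y
  /-- `𝒲` satisfies the two-out-of-three property on short exact sequences. -/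
  thick_two_of_three : ∀ ⦃X Y Z : C⦄ (i : X ⟶ Y) (p : Y ⟶ Z) (w : i ≫ p = 0),
    (ShortComplex.mk i p w).ShortExact →
      ((W X → W Y → W Z) ∧ (W X → W Z → W Y) ∧ (W Y → W Z → W X))
  /-- `Ext¹`-orthogonality of `𝒬` and `𝒲 ∩ ℛ`. -/
  orth₁ : ∀ ⦃X Y : C⦄, Q X → W Y → R Y → Subsingleton (Abelian.Ext X Y 1)
  orth₁_left : ∀ ⦃X : C⦄, (∀ Y : C, W Y → R Y → Subsingleton (Abelian.Ext X Y 1)) → Q X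
  orth₁_right : ∀ ⦃Y : C⦄, (∀ X : C, Q X → Subsingleton (Abelian.Ext X Y 1)) → W Y ∧ R Y
  /-- `Ext¹`-orthogonality of `𝒬 ∩ 𝒲` and `ℛ`. -/
  orth₂ : ∀ ⦃X Y : C⦄, Q X → W X → R Y → Subsingleton (Abelian.Ext X Y 1)
  orth₂_left : ∀ ⦃X : C⦄, (∀ Y : C, R Y → Subsingleton (Abelian.Ext X Y 1)) → Q X ∧ W X
  orth₂_right : ∀ ⦃Y : C⦄, (∀ X : C, Q X → W X → Subsingleton (Abelian.Ext X Y 1)) → R Y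
  /-- the cotorsion pair `(𝒬, 𝒲 ∩ ℛ)` has enough projectives. -/
  complete₁_proj : ∀ A : C, ∃ (K E : C) (i : K ⟶ E) (p : E ⟶ A) (w : i ≫ p = 0),
    Q E ∧ W K ∧ R K ∧ (ShortComplex.mk i p w).ShortExact
  /-- the cotorsion pair `(𝒬, 𝒲 ∩ ℛ)` has enough injectives. -/
  complete₁_inj : ∀ A : C, ∃ (E K : C) (i : A ⟶ E) (p : E ⟶ K) (w : i ≫ p = 0),
    W E ∧ R E ∧ Q K ∧ (ShortComplex.mk i p w).ShortExact
  /-- the cotorsion pair `(𝒬 ∩ 𝒲, ℛ)` has enough projectives. -/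
  complete₂_proj : ∀ A : C, ∃ (K E : C) (i : K ⟶ E) (p : E ⟶ A) (w : i ≫ p = 0),
    Q E ∧ W E ∧ R K ∧ (ShortComplex.mk i p w).ShortExact
  /-- the cotorsion pair `(𝒬 ∩ 𝒲, ℛ)` has enough injectives. -/
  complete₂_inj : ∀ A : C, ∃ (E K : C) (i : A ⟶ E) (p : E ⟶ K) (w : i ≫ p = 0),
    R E ∧ Q K ∧ W K ∧ (ShortComplex.mk i p w).ShortExact
  /-- heredity of `(𝒬, 𝒲 ∩ ℛ)`. -/
  hereditary₁ : ∀ ⦃X Y : C⦄ (i : ℕ), 1 ≤ i → Q X → W Y → R Y →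
    Subsingleton (Abelian.Ext X Y i)
  /-- heredity of `(𝒬 ∩ 𝒲, ℛ)`. -/
  hereditary₂ : ∀ ⦃X Y : C⦄ (i : ℕ), 1 ≤ i → Q X → W X → R Y →
    Subsingleton (Abelian.Ext X Y i)

variable [HasExt.{w} C]

/-- An `𝔐`-resolution of `A`: an everywhere-exact `ℤ`-indexed complex obtained by splicing
a resolution of `A` with components in `𝒬 ∩ 𝒲` and kernels in `ℛ` together with a
coresolution of `A` with components in `𝒲 ∩ ℛ` and cokernels in `𝒬`. -/
structure MResolution (M : HoveyTriple.{w} C) (A : C) where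
  c : ChainComplex C ℤ
  ε : c.X 0 ⟶ A
  η : A ⟶ c.X (-1)
  epi : Epi ε
  mono : Mono η
  fac : c.d 0 (-1) = ε ≫ η
  comp_pos : ∀ n : ℤ, 0 ≤ n → M.Q (c.X n) ∧ M.W (c.X n)
  comp_neg : ∀ n : ℤ, n < 0 → M.W (c.X n) ∧ M.R (c.X n)
  exact : ∀ n : ℤ, (ShortComplex.mk (c.d (n + 1) n) (c.d n (n - 1)) (c.d_comp_d _ _ _)).Exact
  ker_eps : M.R (kernel ε)
  ker_d : ∀ n : ℤ, 1 ≤ n → M.R (kernel (c.d n (n - 1)))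
  cok_eta : M.Q (cokernel η)
  cok_d : ∀ n : ℤ, n ≤ -1 → M.Q (cokernel (c.d n (n - 1)))


open Abelian in
/-- Extension of a map along a short exact sequence when the `Ext¹` obstruction vanishes. -/
lemma aux_extend {S : ShortComplex C} (hS : S.ShortExact) {B : C}
    (hE : Subsingleton (Ext S.X₃ B 1)) (f : S.X₁ ⟶ B) : ∃ g : S.X₂ ⟶ B, S.f ≫ g = f := by
  obtain ⟨x, hx⟩ := Ext.contravariant_sequence_exact₁ hS B (Ext.mk₀ f) (add_zero 1)
    (Subsingleton.elim _ _)
  obtain ⟨g, rfl⟩ := (Ext.mk₀_bijective S.X₂ B).2 x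
  refine ⟨g, ?_⟩
  rw [Ext.mk₀_comp_mk₀] at hx
  exact (Ext.mk₀_bijective _ _).1 hx

open Abelian in
/-- `𝒬` is closed under isomorphisms. -/
lemma HoveyTriple.Q_iso (M : HoveyTriple.{w} C) {X Y : C} (e : X ≅ Y) (h : M.Q X) : M.Q Y := by
  apply M.orth₁_left
  intro B hW hR
  have := M.orth₁ h hW hR
  have key : ∀ x : Ext Y B 1, x = 0 := by
    intro x
    rw [← Ext.mk₀_id_comp x, ← e.inv_hom_id, ← Ext.mk₀_comp_mk₀_assoc,
      Subsingleton.elim ((Ext.mk₀ e.hom).comp x (zero_add 1)) 0, Ext.comp_zero]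
  exact ⟨fun x y => (key x).trans (key y).symm⟩

/-- `𝒲` is closed under isomorphisms. -/
lemma HoveyTriple.W_iso (M : HoveyTriple.{w} C) {X Y : C} (e : X ≅ Y) (h : M.W X) : M.W Y :=
  M.thick_retract ⟨e.inv, e.hom, e.inv_hom_id⟩ h

open Abelian in
/-- `𝒬` is closed under kernels of epimorphisms, by heredity. -/
lemma HoveyTriple.Q_ker (M : HoveyTriple.{w} C) {S : ShortComplex C} (hS : S.ShortExact)
    (h₂ : M.Q S.X₂) (h₃ : M.Q S.X₃) : M.Q S.X₁ := by
  apply M.orth₁_left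
  intro B hW hR
  have e₂ := M.orth₁ h₂ hW hR
  have e₃ := M.hereditary₁ 2 (by norm_num) h₃ hW hR
  have key : ∀ x : Ext S.X₁ B 1, x = 0 := by
    intro x
    obtain ⟨y, hy⟩ := Ext.contravariant_sequence_exact₁ hS B x (show 1 + 1 = 2 from rfl)
      (Subsingleton.elim _ _)
    rw [← hy, Subsingleton.elim y 0, Ext.comp_zero]
  exact ⟨fun x y => (key x).trans (key y).symm⟩

/-- The short exact sequences `0 ⟶ coker d_{j+1} ⟶ X_{j-1} ⟶ coker d_j ⟶ 0`. -/
lemma MResolution.ses {M : HoveyTriple.{w} C} {A : C} (WA : MResolution M A) (i j k : ℤ)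
    (hij : i = j + 1) (hjk : k = j - 1) :
    ∃ (t : cokernel (WA.c.d i j) ⟶ WA.c.X k) (z : t ≫ cokernel.π (WA.c.d j k) = 0),
      cokernel.π (WA.c.d i j) ≫ t = WA.c.d j k ∧ (ShortComplex.mk t _ z).ShortExact := by
  subst hij hjk
  have hm := (WA.exact j).mono_cokernelDesc
  dsimp at hm
  have z : cokernel.desc (WA.c.d (j + 1) j) (WA.c.d j (j - 1)) (WA.c.d_comp_d _ _ _) ≫
      cokernel.π (WA.c.d j (j - 1)) = 0 := by
    rw [← cancel_epi (cokernel.π (WA.c.d (j + 1) j))]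
    simp
  refine ⟨cokernel.desc _ (WA.c.d j (j - 1)) (WA.c.d_comp_d _ _ _), z, by simp, ?_⟩
  have hex := ShortComplex.exact_cokernel (WA.c.d j (j - 1))
  let φ : ShortComplex.mk (WA.c.d j (j - 1)) (cokernel.π (WA.c.d j (j - 1))) (by simp) ⟶
      ShortComplex.mk _ _ z :=
    { τ₁ := cokernel.π _
      τ₂ := 𝟙 _
      τ₃ := 𝟙 _ }
  have h1 : Epi φ.τ₁ := inferInstanceAs (Epi (cokernel.π _))
  have h2 : IsIso φ.τ₂ := inferInstanceAs (IsIso (𝟙 _))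
  have h3 : Mono φ.τ₃ := inferInstanceAs (Mono (𝟙 _))
  exact
    { exact := (ShortComplex.exact_iff_of_epi_of_isIso_of_mono φ).1 hex
      mono_f := hm
      epi_g := inferInstanceAs (Epi (cokernel.π _)) }

/-- `coker d_1 ≅ A`. -/
lemma MResolution.isoA {M : HoveyTriple.{w} C} {A : C} (WA : MResolution M A) :
    Nonempty (cokernel (WA.c.d 1 0) ≅ A) := by
  have := WA.epi
  have := WA.mono
  obtain ⟨t, z, ht, hS⟩ := WA.ses 1 0 (-1) (by norm_num) (by norm_num)
  have w0 : WA.c.d 1 0 ≫ WA.ε = 0 := by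
    rw [← cancel_mono WA.η, Category.assoc, ← WA.fac]
    simp
  have hm : Mono t := hS.mono_f
  have hfac : cokernel.desc (WA.c.d 1 0) WA.ε w0 ≫ WA.η = t := by
    rw [← cancel_epi (cokernel.π (WA.c.d 1 0)), ht, WA.fac]
    simp
  have : Mono (cokernel.desc (WA.c.d 1 0) WA.ε w0 ≫ WA.η) := by rw [hfac]; exact hm
  have : Mono (cokernel.desc (WA.c.d 1 0) WA.ε w0) := mono_of_mono _ WA.η
  have : Epi (cokernel.desc (WA.c.d 1 0) WA.ε w0 ) := inferInstance
  have : IsIso (cokernel.desc (WA.c.d 1 0) WA.ε w0) := isIso_of_mono_of_epi _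
  exact ⟨asIso (cokernel.desc (WA.c.d 1 0) WA.ε w0)⟩

lemma MResolution.Q_nonneg {M : HoveyTriple.{w} C} {A : C} (WA : MResolution M A) (hA : M.Q A)
    (m : ℕ) : ∀ i j : ℤ, j = m → i = j + 1 → M.Q (cokernel (WA.c.d i j)) := by
  induction m with
  | zero =>
    intro i j hj hi
    obtain rfl : j = 0 := by simpa using hj
    obtain rfl : i = 1 := by simpa using hi
    obtain ⟨e⟩ := WA.isoA
    exact M.Q_iso e.symm hA
  | succ m ih =>
    intro i j hj hi
    obtain ⟨t, z, -, hS⟩ := WA.ses i j (m : ℤ) hi (by push_cast at hj; omega)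
    exact M.Q_ker hS (WA.comp_pos _ (by positivity)).1
      (ih j m rfl (by push_cast at hj; omega))

lemma MResolution.Q_all {M : HoveyTriple.{w} C} {A : C} (WA : MResolution M A) (hA : M.Q A)
    (i j : ℤ) (hj : j = i - 1) : M.Q (cokernel (WA.c.d i j)) := by
  rcases lt_trichotomy i 0 with hi | hi | hi
  · subst hj
    exact WA.cok_d i (by omega)
  · subst hi
    obtain rfl : j = -1 := by simpa using hj
    have := WA.epi
    rw [WA.fac]
    exact M.Q_iso (cokernelEpiComp WA.ε WA.η).symm WA.cok_eta
  · exact WA.Q_nonneg hA j.toNat i j (by omega) (by omega)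

lemma MResolution.W_comp {M : HoveyTriple.{w} C} {A : C} (WA : MResolution M A) (n : ℤ) :
    M.W (WA.c.X n) := by
  rcases lt_or_ge n 0 with h | h
  · exact (WA.comp_neg n h).1
  · exact (WA.comp_pos n h).2

lemma MResolution.W_all {M : HoveyTriple.{w} C} {A : C} (WA : MResolution M A) (hA : M.W A)
    (i j : ℤ) (hj : j = i - 1) : M.W (cokernel (WA.c.d i j)) := by
  have up : ∀ i j k : ℤ, i = j + 1 → k = j - 1 →
      (M.W (cokernel (WA.c.d i j)) ↔ M.W (cokernel (WA.c.d j k))) := by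
    intro i j k hi hk
    obtain ⟨t, z, -, hS⟩ := WA.ses i j k hi hk
    have h3 := M.thick_two_of_three _ _ z hS
    exact ⟨fun h => h3.1 h (WA.W_comp k), fun h => h3.2.2 (WA.W_comp k) h⟩
  have main : ∀ j : ℤ, M.W (cokernel (WA.c.d (j + 1) j)) := by
    intro j
    induction j using Int.induction_on with
    | zero =>
      obtain ⟨e⟩ := WA.isoA
      exact M.W_iso e.symm hA
    | succ m ih => exact (up _ _ _ rfl (by omega)).2 ih
    | pred m ih =>
      have := (up _ (-(m : ℤ) - 1 + 1) (-(m : ℤ) - 1) rfl (by omega)).1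
      apply this
      rwa [sub_add_cancel]
  obtain rfl : i = j + 1 := by omega
  exact main j

/-- if `A` is cofibrant and `B` trivially fibrant, or `A` trivially cofibrant
and `B` fibrant, then `ℓExtⁿ_𝔐(A, B) = Hⁿ[Hom(W_A, B)]` vanishes for every integer `n`:
every cocycle of the complex `Hom(W_A, B)` is a coboundary. -/
theorem statement9 (M : HoveyTriple.{w} C) (A B : C)
    (h : (M.Q A ∧ (M.W B ∧ M.R B)) ∨ ((M.Q A ∧ M.W A) ∧ M.R B))
    (WA : MResolution M A) (n : ℤ) (f : WA.c.X n ⟶ B)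
    (hf : WA.c.d (n + 1) n ≫ f = 0) :
    ∃ g : WA.c.X (n - 1) ⟶ B, f = WA.c.d n (n - 1) ≫ g := by
  obtain ⟨t, z, ht, hS⟩ := WA.ses (n + 1) n (n - 1) rfl rfl
  have hE : Subsingleton (Abelian.Ext (cokernel (WA.c.d n (n - 1))) B 1) := by
    rcases h with ⟨hA, hW, hR⟩ | ⟨⟨hA, hWA⟩, hR⟩
    · exact M.orth₁ (WA.Q_all hA _ _ rfl) hW hR
    · exact M.orth₂ (WA.Q_all hA _ _ rfl) (WA.W_all hWA _ _ rfl) hR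
  obtain ⟨g, hg⟩ := aux_extend hS hE (cokernel.desc _ f hf)
  refine ⟨g, ?_⟩
  dsimp at g hg
  rw [← ht, Category.assoc, hg, cokernel.π_desc]
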